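/- arXiv:math/0602093 — 3 statements merged into one kernel-verified Lean document; each statement's English description precedes it below -/
import Mathlib

section
/- Let T be a quasiperiodically forced monotone interval map whose fibre maps are differentiable with continuous strictly positive derivative (θ,x) ↦ DT_θ(x), and suppose there is a continuous T-invariant graph φ with Lyapunov exponent λ(φ) = ∫_{𝕋¹} log DT_θ(φ(θ)) dθ < 0. Then there exist n ∈ ℕ, an open neighbourhood U of the graph Φ = {(θ,φ(θ))} and a constant c < 1 such that the n-th iterate Tⁿ contracts vertical distances within U by factor at most c; in particular no other T-invariant graph ψ can satisfy ψ(θ) ∈ U_θ on a set of θ of positive Lebesgue measure. -/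
open Set MeasureTheory

/-- The circle 𝕋¹ = ℝ/ℤ. -/
abbrev Torus := AddCircle (1 : ℝ)

instance : Fact ((0 : ℝ) < 1) := ⟨one_pos⟩

/-- The `n`-th fibre iterate of a quasiperiodically forced map: it composes the fibre
maps along the rotation orbit `θ, θ+ω, …, θ+(n-1)ω`. -/
noncomputable def fibreIter (ω : ℝ) (T : Torus → ℝ → ℝ) : ℕ → Torus → ℝ → ℝ
  | 0 => fun _ x => x
  | n + 1 => fun θ x => fibreIter ω T n (θ + (ω : Torus)) (T θ x)

open Filter Topology

/-- The derivative of `fibreIter ω T n θ` given by the chain rule, when `DT θ` is the derivative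
of `T θ`. -/
noncomputable def fibreIterDeriv (ω : ℝ) (T DT : Torus → ℝ → ℝ) : ℕ → Torus → ℝ → ℝ
  | 0 => fun _ _ => 1
  | n + 1 => fun θ x => fibreIterDeriv ω T DT n (θ + (ω : Torus)) (T θ x) * DT θ x

section FibreIter

variable {ω : ℝ} {T DT : Torus → ℝ → ℝ}

theorem hasDerivAt_fibreIter (hderiv : ∀ θ x, HasDerivAt (T θ) (DT θ x) x) (n : ℕ) (θ : Torus)
    (x : ℝ) : HasDerivAt (fibreIter ω T n θ) (fibreIterDeriv ω T DT n θ x) x := by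
  induction n generalizing θ x with
  | zero => exact hasDerivAt_id x
  | succ n ih => exact (ih (θ + (ω : Torus)) (T θ x)).comp x (hderiv θ x)

theorem continuous_fibreIterDeriv (hcont : Continuous fun p : Torus × ℝ => T p.1 p.2)
    (hDTcont : Continuous fun p : Torus × ℝ => DT p.1 p.2) (n : ℕ) :
    Continuous fun p : Torus × ℝ => fibreIterDeriv ω T DT n p.1 p.2 := by
  induction n with
  | zero => exact continuous_const
  | succ n ih =>
    have h : Continuous fun p : Torus × ℝ => (p.1 + (ω : Torus), T p.1 p.2) := by fun_prop
    exact (ih.comp h).mul hDTcont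

theorem fibreIterDeriv_pos (hDTpos : ∀ θ x, 0 < DT θ x) (n : ℕ) (θ : Torus) (x : ℝ) :
    0 < fibreIterDeriv ω T DT n θ x := by
  induction n generalizing θ x with
  | zero => exact one_pos
  | succ n ih => exact mul_pos (ih _ _) (hDTpos _ _)

theorem log_fibreIterDeriv_graph (hDTpos : ∀ θ x, 0 < DT θ x) {φ : Torus → ℝ}
    (hφ : ∀ θ, T θ (φ θ) = φ (θ + (ω : Torus))) (n : ℕ) (θ : Torus) :
    Real.log (fibreIterDeriv ω T DT n θ (φ θ)) =
      ∑ k ∈ Finset.range n, Real.log (DT (θ + k • (ω : Torus)) (φ (θ + k • (ω : Torus)))) := by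
  induction n generalizing θ with
  | zero => simp [fibreIterDeriv]
  | succ n ih =>
    have h := ih (θ + (ω : Torus))
    simp only [fibreIterDeriv]
    rw [hφ, Real.log_mul (fibreIterDeriv_pos hDTpos _ _ _).ne' (hDTpos _ _).ne', h,
      Finset.sum_range_succ']
    simp [succ_nsmul', add_assoc]

theorem fibreIter_graph {ψ : Torus → ℝ} (hψ : ∀ θ, T θ (ψ θ) = ψ (θ + (ω : Torus))) (n : ℕ)
    (θ : Torus) : fibreIter ω T n θ (ψ θ) = ψ ((· + (ω : Torus))^[n] θ) := by
  induction n generalizing θ with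
  | zero => rfl
  | succ n ih =>
    simp only [fibreIter]
    rw [hψ, ih, Function.iterate_succ_apply]

end FibreIter

theorem integral_fourier_eq_zero {α : Torus} {n : ℤ} (hα : fourier n α ≠ 1) :
    ∫ θ : Torus, (fourier n θ : ℂ) = 0 := by
  have h := integral_add_right_eq_self (μ := (volume : Measure Torus))
    (fun θ => (fourier n θ : ℂ)) α
  have h2 : ∀ θ, (fourier n (θ + α) : ℂ) = fourier n θ * fourier n α := fun θ => by
    simp only [fourier_apply, smul_add, AddCircle.toCircle_add, Circle.coe_mul]
  simp_rw [h2, integral_mul_const] at h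
  have h3 : (∫ θ : Torus, (fourier n θ : ℂ)) * ((fourier n α : ℂ) - 1) = 0 := by
    rw [mul_sub, h]; ring
  exact (mul_eq_zero.1 h3).resolve_right (sub_ne_zero.2 hα)

theorem fourier_ne_one {α : Torus} (hα : addOrderOf α = 0) {n : ℤ} (hn : n ≠ 0) :
    (fourier n α : ℂ) ≠ 1 := by
  intro h
  rw [fourier_apply, Circle.coe_eq_one, ← AddCircle.toCircle_zero (T := (1 : ℝ))] at h
  have h0 := AddCircle.injective_toCircle one_ne_zero h
  exact (addOrderOf_eq_zero_iff.1 hα) (isOfFinAddOrder_iff_zsmul_eq_zero.2 ⟨n, hn, h0⟩)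

theorem exists_norm_sum_fourier_sub_integral_le {α : Torus} (hα : addOrderOf α = 0) (n : ℤ) :
    ∃ C : ℝ, ∀ (N : ℕ) (θ : Torus),
      ‖∑ k ∈ Finset.range N, (fourier n (θ + k • α) : ℂ) - N * ∫ θ : Torus, (fourier n θ : ℂ)‖
        ≤ C := by
  rcases eq_or_ne n 0 with rfl | hn
  · refine ⟨0, fun N θ => ?_⟩
    simp [measureReal_def]
  have hz := fourier_ne_one hα hn
  refine ⟨2 / ‖(fourier n α : ℂ) - 1‖, fun N θ => ?_⟩
  have hk : ∀ k : ℕ, (fourier n (θ + k • α) : ℂ) = fourier n θ * (fourier n α : ℂ) ^ k := by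
    intro k
    simp only [fourier_apply, smul_add, AddCircle.toCircle_add, Circle.coe_mul]
    rw [smul_comm, AddCircle.toCircle_nsmul, Circle.coe_pow]
  have hnorm : ∀ θ : Torus, ‖(fourier n θ : ℂ)‖ = 1 := fun θ => Circle.norm_coe _
  simp_rw [integral_fourier_eq_zero hz, hk, ← Finset.mul_sum, geom_sum_eq hz]
  rw [mul_zero, sub_zero, norm_mul, norm_div, hnorm, one_mul]
  gcongr
  refine (norm_sub_le _ _).trans ?_
  rw [norm_pow, hnorm]
  norm_num

/-- The deviations of the Birkhoff sums of a trigonometric polynomial over an irrational rotation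
are bounded. -/
theorem exists_norm_sum_trig_sub_integral_le {α : Torus} (hα : addOrderOf α = 0)
    {p : C(Torus, ℂ)} (hp : p ∈ Submodule.span ℂ (range (@fourier (1 : ℝ)))) :
    ∃ C : ℝ, ∀ (N : ℕ) (θ : Torus),
      ‖∑ k ∈ Finset.range N, p (θ + k • α) - N * ∫ θ : Torus, p θ‖ ≤ C := by
  induction hp using Submodule.span_induction with
  | mem x h =>
    obtain ⟨n, rfl⟩ := h
    exact exists_norm_sum_fourier_sub_integral_le hα n
  | zero => exact ⟨0, by simp⟩
  | add x y _ _ hx hy =>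
    obtain ⟨C, hC⟩ := hx
    obtain ⟨C', hC'⟩ := hy
    refine ⟨C + C', fun N θ => ?_⟩
    have hint (q : C(Torus, ℂ)) : Integrable q volume :=
      q.continuous.integrable_of_hasCompactSupport (HasCompactSupport.of_compactSpace _)
    simp only [ContinuousMap.add_apply, Finset.sum_add_distrib, integral_add (hint x) (hint y)]
    rw [mul_add, add_sub_add_comm]
    exact (norm_add_le _ _).trans (add_le_add (hC N θ) (hC' N θ))
  | smul a x _ hx =>
    obtain ⟨C, hC⟩ := hx
    refine ⟨‖a‖ * C, fun N θ => ?_⟩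
    simp only [ContinuousMap.smul_apply, smul_eq_mul, ← Finset.mul_sum, integral_const_mul]
    rw [mul_left_comm, ← mul_sub, norm_mul]
    gcongr
    exact hC N θ

/-- Birkhoff sums of a continuous function over an irrational rotation deviate from the mean
by `o(N)`, uniformly in the base point. -/
theorem exists_norm_sum_sub_integral_le {α : Torus} (hα : addOrderOf α = 0) (f : C(Torus, ℂ))
    {ε : ℝ} (hε : 0 < ε) :
    ∃ C : ℝ, ∀ (N : ℕ) (θ : Torus),
      ‖∑ k ∈ Finset.range N, f (θ + k • α) - N * ∫ θ : Torus, f θ‖ ≤ C + N * ε := by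
  have hf : f ∈ closure (Submodule.span ℂ (range (@fourier (1 : ℝ))) : Set C(Torus, ℂ)) := by
    rw [← Submodule.topologicalClosure_coe, span_fourier_closure_eq_top]
    trivial
  obtain ⟨p, hp, hfp⟩ := Metric.mem_closure_iff.1 hf (ε / 2) (half_pos hε)
  obtain ⟨C, hC⟩ := exists_norm_sum_trig_sub_integral_le hα hp
  have hpt (θ : Torus) : ‖f θ - p θ‖ ≤ ε / 2 := by
    rw [← dist_eq_norm]
    exact (ContinuousMap.dist_apply_le_dist θ).trans hfp.le
  have hint (q : C(Torus, ℂ)) : Integrable q volume :=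
    q.continuous.integrable_of_hasCompactSupport (HasCompactSupport.of_compactSpace _)
  have hI : ‖(∫ θ : Torus, f θ) - ∫ θ : Torus, p θ‖ ≤ ε / 2 := by
    rw [← integral_sub (hint f) (hint p)]
    refine (norm_integral_le_of_norm_le_const (.of_forall hpt)).trans ?_
    simp [measureReal_def]
  refine ⟨C, fun N θ => ?_⟩
  have hS : ‖∑ k ∈ Finset.range N, (f (θ + k • α) - p (θ + k • α))‖ ≤ N * (ε / 2) := by
    refine (norm_sum_le_of_le _ fun k _ => hpt _).trans ?_
    simp
  have hNI : ‖(N : ℂ) * ((∫ θ : Torus, f θ) - ∫ θ : Torus, p θ)‖ ≤ N * (ε / 2) := by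
    rw [norm_mul, Complex.norm_natCast]
    gcongr
  have hsplit : ∑ k ∈ Finset.range N, f (θ + k • α) - N * ∫ θ : Torus, f θ =
      (∑ k ∈ Finset.range N, p (θ + k • α) - N * ∫ θ : Torus, p θ) +
      (∑ k ∈ Finset.range N, (f (θ + k • α) - p (θ + k • α)) -
        N * ((∫ θ : Torus, f θ) - ∫ θ : Torus, p θ)) := by
    rw [Finset.sum_sub_distrib]; ring
  rw [hsplit]
  refine (norm_add_le _ _).trans ?_
  linarith [hC N θ, norm_sub_le (∑ k ∈ Finset.range N, (f (θ + k • α) - p (θ + k • α)))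
    (N * ((∫ θ : Torus, f θ) - ∫ θ : Torus, p θ))]

/-- A continuous function with negative mean has an everywhere negative Birkhoff sum over an
irrational rotation. -/
theorem exists_forall_sum_neg_of_integral_neg {α : Torus} (hα : addOrderOf α = 0) {f : Torus → ℝ}
    (hf : Continuous f) (hneg : (∫ θ, f θ) < 0) :
    ∃ N : ℕ, ∀ θ, ∑ k ∈ Finset.range N, f (θ + k • α) < 0 := by
  set I := ∫ θ, f θ with hI
  obtain ⟨C, hC⟩ := exists_norm_sum_sub_integral_le hα
    ⟨fun θ => (f θ : ℂ), Complex.continuous_ofReal.comp hf⟩ (ε := -I / 2) (by linarith)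
  obtain ⟨N, hN⟩ := exists_nat_gt (C / (-I / 2))
  rw [div_lt_iff₀ (by linarith)] at hN
  refine ⟨N, fun θ => ?_⟩
  have h := hC N θ
  simp only [ContinuousMap.coe_mk, integral_complex_ofReal] at h
  rw [← hI, ← Complex.ofReal_natCast, ← Complex.ofReal_sum, ← Complex.ofReal_mul,
    ← Complex.ofReal_sub, Complex.norm_real, Real.norm_eq_abs] at h
  linarith [(abs_le.1 h).2]

/-- If a measurable function tends to zero along the orbits of a conservative map starting in `s`,
then it is nonpositive almost everywhere on `s`. -/
theorem MeasureTheory.Conservative.ae_le_zero_of_tendsto {X : Type*} [MeasurableSpace X]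
    {μ : Measure X} {f : X → X} (hf : Conservative f μ) {d : X → ℝ} (hd : Measurable d)
    {s : Set X} (hs : MeasurableSet s)
    (h : ∀ x ∈ s, Tendsto (fun k => d (f^[k] x)) atTop (𝓝 0)) : ∀ᵐ x ∂μ, x ∈ s → d x ≤ 0 := by
  have hrec : ∀ m : ℕ, ∀ᵐ x ∂μ, x ∈ s → d x ≤ 1 / ((m : ℝ) + 1) := fun m => by
    have hm : MeasurableSet (s ∩ {x | 1 / ((m : ℝ) + 1) < d x}) :=
      hs.inter (measurableSet_lt measurable_const hd)
    filter_upwards [hf.ae_mem_imp_frequently_image_mem hm.nullMeasurableSet] with x hx hxs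
    by_contra! hlt
    obtain ⟨k, hk, hk'⟩ := ((hx ⟨hxs, hlt⟩).and_eventually
      ((h x hxs).eventually (gt_mem_nhds Nat.one_div_pos_of_nat))).exists
    exact lt_asymm hk' hk.2
  filter_upwards [ae_all_iff.2 hrec] with x hx hxs
  exact ge_of_tendsto' tendsto_one_div_add_atTop_nhds_zero_nat fun m => hx m hxs

/-- Two measurable graphs, invariant under an ergodic base map and injective fibre maps, which
agree on a nonnull set agree almost everywhere. -/
theorem Ergodic.ae_eq_or_ae_ne_of_invariant_graph {X : Type*} [MeasurableSpace X] {μ : Measure X}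
    {R : X → X} (hR : Ergodic R μ) {T : X → ℝ → ℝ} {φ ψ : X → ℝ}
    (hinj : ∀ x, T x (ψ x) = T x (φ x) → ψ x = φ x) (hφm : Measurable φ) (hψm : Measurable ψ)
    (hφ : ∀ x, T x (φ x) = φ (R x)) (hψ : ∀ x, T x (ψ x) = ψ (R x)) :
    ψ =ᵐ[μ] φ ∨ ∀ᵐ x ∂μ, ψ x ≠ φ x := by
  refine hR.toPreErgodic.ae_mem_or_ae_notMem (measurableSet_eq_fun hψm hφm) ?_
  ext x
  change ψ (R x) = φ (R x) ↔ ψ x = φ x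
  rw [← hφ, ← hψ]
  exact ⟨hinj x, fun h => by rw [h]⟩

/-- A continuous invariant graph `φ` with negative Lyapunov exponent of a
quasiperiodically forced C¹ monotone interval map attracts uniformly: some iterate `Tⁿ`
contracts vertical distances by a factor `c < 1` on an open neighbourhood `U` of the graph;
in particular no other invariant graph can meet `U` over a set of `θ` of positive measure. -/
theorem stable_continuous_graph_attracts
    (ω : ℝ) (hω : Irrational ω) (a b : ℝ) (hab : a ≤ b)
    (T DT : Torus → ℝ → ℝ)
    (hmaps : ∀ θ, MapsTo (T θ) (Icc a b) (Icc a b))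
    (hmono : ∀ θ, MonotoneOn (T θ) (Icc a b))
    (hcont : Continuous fun p : Torus × ℝ => T p.1 p.2)
    (hDTcont : Continuous fun p : Torus × ℝ => DT p.1 p.2)
    (hDTpos : ∀ θ x, 0 < DT θ x)
    (hderiv : ∀ θ x, HasDerivAt (T θ) (DT θ x) x)
    (φ : Torus → ℝ) (hφcont : Continuous φ) (hφmem : ∀ θ, φ θ ∈ Icc a b)
    (hφinv : ∀ θ, T θ (φ θ) = φ (θ + (ω : Torus)))
    (hlyap : (∫ θ : Torus, Real.log (DT θ (φ θ))) < 0) :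
    ∃ (n : ℕ) (U : Set (Torus × ℝ)) (c : ℝ), IsOpen U ∧ c < 1 ∧
      (∀ θ, (θ, φ θ) ∈ U) ∧
      (∀ θ x y, (θ, x) ∈ U → (θ, y) ∈ U →
        |fibreIter ω T n θ x - fibreIter ω T n θ y| ≤ c * |x - y|) ∧
      (∀ ψ : Torus → ℝ, Measurable ψ → (∀ θ, ψ θ ∈ Icc a b) →
        (∀ θ, T θ (ψ θ) = ψ (θ + (ω : Torus))) → ¬ (ψ =ᵐ[volume] φ) →
        volume {θ : Torus | (θ, ψ θ) ∈ U} = 0) := by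
  have hord : addOrderOf (ω : Torus) = 0 := by
    rw [addOrderOf_eq_zero_iff, AddCircle.isOfFinAddOrder_iff_exists_rat_eq_div]
    simpa [Irrational] using hω
  have hinj (θ : Torus) : Function.Injective (T θ) :=
    (strictMono_of_hasDerivAt_pos (hderiv θ) (hDTpos θ)).injective
  have hlog : Continuous fun θ => Real.log (DT θ (φ θ)) :=
    (hDTcont.comp (continuous_id.prodMk hφcont)).log fun θ => (hDTpos _ _).ne'
  obtain ⟨n, hn⟩ := exists_forall_sum_neg_of_integral_neg hord hlog hlyap
  set D := fibreIterDeriv ω T DT n with hD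
  have hDcont : Continuous fun p : Torus × ℝ => D p.1 p.2 :=
    continuous_fibreIterDeriv hcont hDTcont n
  have hDpos (θ : Torus) (x : ℝ) : 0 < D θ x := fibreIterDeriv_pos hDTpos n θ x
  have hDlt (θ : Torus) : D θ (φ θ) < 1 := by
    rw [← Real.log_neg_iff (hDpos _ _), hD, log_fibreIterDeriv_graph hDTpos hφinv]
    exact hn θ
  obtain ⟨θ₀, hθ₀⟩ :=
    (hDcont.comp (continuous_id.prodMk hφcont)).exists_forall_ge_of_hasCompactSupport
      (HasCompactSupport.of_compactSpace _)
  obtain ⟨c, hc₀, hc₁⟩ := exists_between (hDlt θ₀)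
  have hcpos : 0 < c := (hDpos _ _).trans hc₀
  obtain ⟨ε, hε, hball⟩ : ∃ ε > 0, ∀ θ x, |x - φ θ| < ε → D θ x < c := by
    have hopen : IsOpen {p : Torus × ℝ | D p.1 (φ p.1 + p.2) < c} :=
      isOpen_lt (hDcont.comp (continuous_fst.prodMk
        ((hφcont.comp continuous_fst).add continuous_snd))) continuous_const
    obtain ⟨u, v, -, hv, hu, h0, huv⟩ := generalized_tube_lemma
      (isCompact_univ (X := Torus)) (isCompact_singleton (x := (0 : ℝ))) hopen (by
        rintro ⟨θ, t⟩ ⟨-, rfl⟩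
        simpa using (hθ₀ θ).trans_lt hc₀)
    obtain ⟨ε, hε, hεv⟩ := Metric.isOpen_iff.1 hv 0 (h0 rfl)
    refine ⟨ε, hε, fun θ x hx => ?_⟩
    have hmem : (θ, x - φ θ) ∈ u ×ˢ v :=
      ⟨hu (mem_univ θ), hεv (by simpa [Real.dist_eq] using hx)⟩
    simpa using huv hmem
  have hcontr (θ : Torus) (x y : ℝ) (hx : |x - φ θ| < ε) (hy : |y - φ θ| < ε) :
      |fibreIter ω T n θ x - fibreIter ω T n θ y| ≤ c * |x - y| := by
    refine (convex_ball (φ θ) ε).norm_image_sub_le_of_norm_hasDerivWithin_le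
      (fun z _ => (hasDerivAt_fibreIter hderiv n θ z).hasDerivWithinAt) (fun z hz => ?_) hy hx
    rw [Real.norm_of_nonneg (hDpos θ z).le]
    exact (hball θ z hz).le
  refine ⟨n, {p | |p.2 - φ p.1| < ε}, c, ?_, hc₁, fun θ => by simpa using hε, hcontr, ?_⟩
  · exact isOpen_lt (continuous_snd.sub (hφcont.comp continuous_fst)).abs continuous_const
  intro ψ hψm _ hψinv hne
  have herg : Ergodic (· + (ω : Torus)) (volume : Measure Torus) :=
    AddCircle.ergodic_add_right.2 hord
  have hne' := (herg.ae_eq_or_ae_ne_of_invariant_graph (fun θ h => hinj θ h)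
    hφcont.measurable hψm hφinv hψinv).resolve_left hne
  have hdm : Measurable fun θ => |ψ θ - φ θ| := (hψm.sub hφcont.measurable).abs
  have hdecay (θ : Torus) (hθ : |ψ θ - φ θ| < ε) (k : ℕ) :
      |ψ (((· + (ω : Torus))^[n])^[k] θ) - φ (((· + (ω : Torus))^[n])^[k] θ)| ≤
        c ^ k * |ψ θ - φ θ| := by
    induction k with
    | zero => simp
    | succ k ih =>
      rw [Function.iterate_succ_apply']
      set η := ((· + (ω : Torus))^[n])^[k] θ
      have hη : |ψ η - φ η| < ε :=
        (ih.trans (mul_le_of_le_one_left (abs_nonneg _) (pow_le_one₀ hcpos.le hc₁.le))).trans_lt hθ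
      have h := hcontr η (ψ η) (φ η) hη (by simpa using hε)
      rw [fibreIter_graph hψinv, fibreIter_graph hφinv] at h
      calc _ ≤ c * |ψ η - φ η| := h
        _ ≤ c * (c ^ k * |ψ θ - φ θ|) := by gcongr
        _ = _ := by ring
  have hle := (herg.toMeasurePreserving.conservative.iterate n).ae_le_zero_of_tendsto hdm
    (s := {θ | |ψ θ - φ θ| < ε}) (measurableSet_lt hdm measurable_const) fun θ hθ =>
      squeeze_zero (fun _ => abs_nonneg _) (hdecay θ hθ)
        (by simpa using (tendsto_pow_atTop_nhds_zero_of_lt_one hcpos.le hc₁).mul_const _)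
  rw [measure_eq_zero_iff_ae_notMem]
  filter_upwards [hle, hne'] with θ h₁ h₂ hθ
  exact h₂ (sub_eq_zero.1 (abs_nonpos_iff.1 (h₁ hθ)))
end

section
/- Let T be a quasiperiodically forced monotone interval map with C¹ fibre maps, continuous strictly positive derivative (θ,x) ↦ DT_θ(x), and invertible fibre maps. If there exists a point (θ₀,x₀) whose upper forward Lyapunov exponent λ⁺(θ₀,x₀) = limsup_{n→∞} (1/n) Σ_{i=0}^{n-1} log DT_{θ₀+iω}(T_{θ₀}^i(x₀)) and upper backward Lyapunov exponent λ⁻(θ₀,x₀) = limsup_{n→∞} −(1/n) Σ_{i=1}^{n} log DT_{θ₀−iω}(T_{θ₀}^{−i}(x₀)) are both strictly positive (a weak sink-source orbit), then there exists a T-invariant graph which has negative Lyapunov exponent and is not continuous (a strange non-chaotic attractor). -/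
open Set MeasureTheory Filter

section InvariantMeasures

open scoped Topology ENNReal

variable {Y : Type*} [MetricSpace Y] [CompactSpace Y] [MeasurableSpace Y] [BorelSpace Y]

/-- The empirical measure of an orbit segment computes Birkhoff averages. -/
lemma exists_probabilityMeasure_integral_eq_birkhoffAverage (S : Y → Y) (z : Y) (n : ℕ) :
    ∃ ν : ProbabilityMeasure Y, n ≠ 0 →
      ∀ f : Y → ℝ, ∫ y, f y ∂(ν : Measure Y) = birkhoffAverage ℝ S f n z := by
  by_cases hn : n = 0
  · exact ⟨⟨Measure.dirac z, inferInstance⟩, fun h => absurd hn h⟩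
  · refine ⟨⟨(n : ℝ≥0∞)⁻¹ • ∑ i ∈ Finset.range n, Measure.dirac (S^[i] z), ⟨?_⟩⟩, fun _ f => ?_⟩
    · simp [ENNReal.inv_mul_cancel (Nat.cast_ne_zero.2 hn) (ENNReal.natCast_ne_top n)]
    · simp only [ProbabilityMeasure.coe_mk]
      rw [integral_smul_measure, integral_finsetSum_measure]
      · simp [birkhoffAverage, birkhoffSum]
      · exact fun i _ => integrable_dirac (by simp)

/-- **Krylov–Bogolyubov**, along finite orbit segments with varying starting points. -/
lemma exists_invariant_measure_of_frequently_birkhoffAverage_le {S : Y → Y} (hS : Continuous S)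
    {g : Y → ℝ} (hg : Continuous g) (z : ℕ → Y) {c : ℝ}
    (hz : ∃ᶠ n in atTop, birkhoffAverage ℝ S g n (z n) ≤ c) {C : Set Y} (hC : IsClosed C)
    (hzC : ∀ n, ∀ i < n, S^[i] (z n) ∈ C) :
    ∃ μ : Measure Y, IsProbabilityMeasure μ ∧ MeasurePreserving S μ μ ∧
      ∫ y, g y ∂μ ≤ c ∧ ∀ᵐ y ∂μ, y ∈ C := by
  choose ν hν using fun n => exists_probabilityMeasure_integral_eq_birkhoffAverage S (z n) n
  set F : Filter ℕ := atTop ⊓ 𝓟 {n | birkhoffAverage ℝ S g n (z n) ≤ c} with hF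
  have : F.NeBot := frequently_mem_iff_neBot.1 hz
  set U : Ultrafilter ℕ := Ultrafilter.of F
  have hUF : (U : Filter ℕ) ≤ F := Ultrafilter.of_le F
  have hUtop : (U : Filter ℕ) ≤ atTop := hUF.trans inf_le_left
  have hUle : ∀ᶠ n in (U : Filter ℕ), birkhoffAverage ℝ S g n (z n) ≤ c :=
    (hUF.trans inf_le_right) (mem_principal_self _)
  have hUne : ∀ᶠ n in (U : Filter ℕ), n ≠ 0 := hUtop (eventually_ne_atTop 0)
  obtain ⟨μ, -, hμ⟩ := isCompact_univ.ultrafilter_le_nhds (U.map ν) (by simp)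
  have hlim : ∀ f : Y → ℝ, Continuous f → Tendsto (fun n => birkhoffAverage ℝ S f n (z n)) U
      (𝓝 (∫ y, f y ∂(μ : Measure Y))) := by
    intro f hf
    have h := ProbabilityMeasure.tendsto_iff_forall_integral_tendsto.1
      (show Tendsto ν U (𝓝 μ) from hμ) (BoundedContinuousFunction.mkOfCompact ⟨f, hf⟩)
    refine h.congr' ?_
    filter_upwards [hUne] with n hn
    simpa using hν n hn f
  refine ⟨μ, inferInstance, ⟨hS.measurable, ?_⟩, le_of_tendsto (hlim g hg) hUle, ?_⟩
  · have := Measure.isProbabilityMeasure_map (μ := (μ : Measure Y)) hS.measurable.aemeasurable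
    refine ext_of_forall_integral_eq_of_IsFiniteMeasure fun f => ?_
    rw [integral_map hS.measurable.aemeasurable f.continuous.aestronglyMeasurable]
    have hdiff := (hlim _ (f.continuous.comp hS)).sub (hlim _ f.continuous)
    refine sub_eq_zero.1 (tendsto_nhds_unique hdiff ?_)
    have hb : Tendsto (fun n : ℕ => (n : ℝ)⁻¹ * (2 * ‖f‖)) U (𝓝 0) := by
      simpa using ((tendsto_inv_atTop_nhds_zero_nat (𝕜 := ℝ)).mul_const (2 * ‖f‖)).mono_left hUtop
    refine squeeze_zero_norm (fun n => ?_) hb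
    have : birkhoffAverage ℝ S (f ∘ S) n (z n) = birkhoffAverage ℝ S f n (S (z n)) := by
      simp [birkhoffAverage, birkhoffSum, ← Function.iterate_succ_apply',
        Function.iterate_succ_apply]
    rw [this, birkhoffAverage_apply_sub_birkhoffAverage, norm_smul]
    gcongr
    · simp
    · rw [← dist_eq_norm]
      exact f.dist_le_two_norm _ _
  · rcases C.eq_empty_or_nonempty with hCe | hCne
    · obtain ⟨n, hn⟩ := hUne.exists
      have := hzC n 0 (Nat.pos_of_ne_zero hn)
      simp [hCe] at this
    have h0 : ∫ y, Metric.infDist y C ∂(μ : Measure Y) = 0 := by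
      refine tendsto_nhds_unique (hlim _ (Metric.continuous_infDist_pt C)) ?_
      refine tendsto_const_nhds.congr fun n => ?_
      rw [birkhoffAverage, birkhoffSum, Finset.sum_eq_zero, smul_zero]
      exact fun i hi => Metric.infDist_zero_of_mem (hzC n i (Finset.mem_range.1 hi))
    have hintegr : Integrable (fun y => Metric.infDist y C) (μ : Measure Y) :=
      (Metric.continuous_infDist_pt C).integrable_of_hasCompactSupport
        (HasCompactSupport.of_compactSpace _)
    have h1 := (integral_eq_zero_iff_of_nonneg (fun y => Metric.infDist_nonneg) hintegr).1 h0
    filter_upwards [h1] with y hy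
    exact (hC.mem_iff_infDist_zero hCne).2 hy

end InvariantMeasures

section Rotation

instance : IsProbabilityMeasure (volume : Measure Torus) := ⟨by simp [AddCircle.measure_univ]⟩

/-- An irrational rotation of the circle is uniquely ergodic. -/
lemma eq_volume_of_measurePreserving_irrational_rotation {ω : ℝ} (hω : Irrational ω)
    (μ : Measure Torus) [IsProbabilityMeasure μ]
    (hμ : MeasurePreserving (fun θ : Torus => θ + (ω : Torus)) μ μ) : μ = volume := by
  have hcts : ∀ f : BoundedContinuousFunction Torus ℝ,
      Continuous fun t : Torus => ∫ θ, f (t + θ) ∂μ := by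
    intro f
    refine continuous_of_dominated (bound := fun _ => ‖f‖) (fun t => ?_) (fun t => ?_) ?_ ?_
    · exact (by fun_prop : Continuous fun θ => f (t + θ)).aestronglyMeasurable
    · exact Eventually.of_forall fun θ => f.norm_coe_le_norm _
    · exact integrable_const _
    · exact Eventually.of_forall fun θ => by fun_prop
  have hz : ∀ n : ℤ, MeasurePreserving (fun θ : Torus => n • (ω : Torus) + θ) μ μ := by
    have hN : ∀ n : ℕ, MeasurePreserving (fun θ : Torus => n • (ω : Torus) + θ) μ μ := by
      intro n
      convert hμ.iterate n using 1
      ext θ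
      simp [add_comm]
    intro n
    obtain ⟨m, rfl | rfl⟩ := n.eq_nat_or_neg
    · simpa using hN m
    · convert MeasurePreserving.symm (MeasurableEquiv.addLeft (m • (ω : Torus))) (hN m) using 1
      ext θ
      simp
  have hdense : DenseRange fun n : ℤ => n • (ω : Torus) :=
    AddCircle.denseRange_zsmul_coe_iff.2 (by simpa using hω)
  have hinv : μ.IsAddLeftInvariant := by
    refine ⟨fun t => ?_⟩
    have := Measure.isProbabilityMeasure_map (μ := μ) (measurable_const_add t).aemeasurable
    refine ext_of_forall_integral_eq_of_IsFiniteMeasure fun f => ?_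
    rw [integral_map (measurable_const_add t).aemeasurable f.continuous.aestronglyMeasurable]
    refine congrFun (hdense.equalizer (hcts f) (continuous_const (y := ∫ θ, f θ ∂μ)) ?_) t
    ext n
    rw [Function.comp_apply, ← integral_map (hz n).measurable.aemeasurable
      f.continuous.aestronglyMeasurable, (hz n).map_eq]
    rfl
  have : μ.IsAddHaarMeasure := by
    exact Measure.isAddHaarMeasure_of_isCompact_nonempty_interior μ univ isCompact_univ
      (by simp) (by simp) (by simp)
  exact Measure.isAddHaarMeasure_eq_of_isProbabilityMeasure _ _

/-- Uniform upper bound for the Birkhoff averages of a continuous function over an irrational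
rotation. -/
lemma eventually_forall_birkhoffAverage_rotation_lt {ω : ℝ} (hω : Irrational ω) {h : Torus → ℝ}
    (hh : Continuous h) {c : ℝ} (hc : ∫ θ, h θ < c) :
    ∀ᶠ n in atTop, ∀ θ, birkhoffAverage ℝ (fun θ : Torus => θ + (ω : Torus)) h n θ < c := by
  by_contra hcon
  have hfreq := not_eventually.1 hcon
  have hz : ∀ n : ℕ, ∃ z : Torus,
      (¬ ∀ θ, birkhoffAverage ℝ (fun θ : Torus => θ + (ω : Torus)) h n θ < c) →
        birkhoffAverage ℝ (fun θ : Torus => θ + (ω : Torus)) (-h) n z ≤ -c := by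
    intro n
    by_cases H : ∀ θ, birkhoffAverage ℝ (fun θ : Torus => θ + (ω : Torus)) h n θ < c
    · exact ⟨0, fun H' => absurd H H'⟩
    · push Not at H
      obtain ⟨θ, hθ⟩ := H
      exact ⟨θ, fun _ => by rw [birkhoffAverage_neg]; simpa using hθ⟩
  choose z hz using hz
  obtain ⟨μ, hμ, hpres, hle, -⟩ := exists_invariant_measure_of_frequently_birkhoffAverage_le
    (by fun_prop) hh.neg z (hfreq.mono hz) isClosed_univ (fun _ _ _ => mem_univ _)
  obtain rfl := eq_volume_of_measurePreserving_irrational_rotation hω μ hpres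
  simp only [Pi.neg_apply, integral_neg] at hle
  linarith

end Rotation

section Quantile

open ProbabilityTheory
open scoped Topology

/-- The quantile function of a measure on `ℝ`, clamped to the interval `[a, b]`. -/
noncomputable def clampedQuantile (a b : ℝ) (ν : Measure ℝ) (s : ℝ) : ℝ :=
  sInf {x | x ∈ Icc a b ∧ (s ≤ ν.real (Iic x) ∨ x = b)}

variable {a b : ℝ} {ν : Measure ℝ} {s x : ℝ}

lemma clampedQuantile_mem (hab : a ≤ b) : clampedQuantile a b ν s ∈ Icc a b :=
  ⟨le_csInf ⟨b, right_mem_Icc.2 hab, .inr rfl⟩ fun _ hx => hx.1.1,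
    csInf_le ⟨a, fun _ hx => hx.1.1⟩ ⟨right_mem_Icc.2 hab, .inr rfl⟩⟩

lemma clampedQuantile_le_iff [IsProbabilityMeasure ν] (hab : a ≤ b) (hx : x ∈ Icc a b) :
    clampedQuantile a b ν s ≤ x ↔ s ≤ ν.real (Iic x) ∨ x = b := by
  refine ⟨fun h => ?_, fun h => csInf_le ⟨a, fun _ hx => hx.1.1⟩ ⟨hx, h⟩⟩
  by_contra! hcon
  obtain ⟨h1, h2⟩ := hcon
  have hxb : x < b := lt_of_le_of_ne hx.2 h2
  have hcont : Tendsto (cdf ν) (𝓝[>] x) (𝓝 (cdf ν x)) :=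
    ((cdf ν).right_continuous x).mono Ioi_subset_Ici_self
  refine absurd h1 (not_lt.2 ?_)
  rw [← cdf_eq_real]
  refine ge_of_tendsto hcont ?_
  filter_upwards [Ioo_mem_nhdsGT hxb] with y hy
  obtain ⟨w, ⟨-, hw | rfl⟩, hwy⟩ := exists_lt_of_csInf_lt
    (s := {x | x ∈ Icc a b ∧ (s ≤ ν.real (Iic x) ∨ x = b)})
    ⟨b, right_mem_Icc.2 hab, Or.inr rfl⟩ (h.trans_lt hy.1)
  · rw [cdf_eq_real]
    exact hw.trans (measureReal_mono (Iic_subset_Iic.2 hwy.le))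
  · exact absurd hwy (not_lt.2 hy.2.le)

lemma measurable_clampedQuantile (hab : a ≤ b) {α : Type*} [MeasurableSpace α] (κ : Kernel α ℝ)
    [IsMarkovKernel κ] : Measurable fun p : α × ℝ => clampedQuantile a b (κ p.1) p.2 := by
  refine measurable_of_Iic fun x => ?_
  by_cases hxa : x < a
  · convert MeasurableSet.empty
    ext p
    simpa using hxa.trans_le (clampedQuantile_mem hab).1
  by_cases hxb : b ≤ x
  · convert MeasurableSet.univ
    ext p
    simpa using (clampedQuantile_mem hab).2.trans hxb
  push Not at hxa hxb
  have : (fun p : α × ℝ => clampedQuantile a b (κ p.1) p.2) ⁻¹' Iic x =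
      {p | p.2 ≤ (κ p.1).real (Iic x)} := by
    ext p
    simp [clampedQuantile_le_iff hab ⟨hxa, hxb.le⟩, hxb.ne]
  rw [this]
  exact measurableSet_le measurable_snd
    ((κ.measurable_coe measurableSet_Iic).ennreal_toReal.comp measurable_fst)

lemma clampedQuantile_map [IsProbabilityMeasure ν] (hab : a ≤ b) {f : ℝ → ℝ} (hf : Measurable f)
    (hmono : StrictMono f) (hbij : BijOn f (Icc a b) (Icc a b)) (hfb : f b = b) :
    clampedQuantile a b (ν.map f) s = f (clampedQuantile a b ν s) := by
  have := Measure.isProbabilityMeasure_map (μ := ν) hf.aemeasurable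
  have key : ∀ y ∈ Icc a b,
      clampedQuantile a b (ν.map f) s ≤ y ↔ f (clampedQuantile a b ν s) ≤ y := by
    intro y hy
    obtain ⟨x, hx, rfl⟩ := hbij.surjOn hy
    have hpre : f ⁻¹' Iic (f x) = Iic x := by
      ext z
      simp [hmono.le_iff_le]
    have hxb : f x = b ↔ x = b := by
      rw [← hmono.injective.eq_iff (a := x), hfb]
    rw [clampedQuantile_le_iff hab hy, hmono.le_iff_le, clampedQuantile_le_iff hab hx,
      map_measureReal_apply hf measurableSet_Iic, hpre, hxb]
  exact le_antisymm ((key _ (hbij.mapsTo (clampedQuantile_mem hab))).2 le_rfl)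
    ((key _ (clampedQuantile_mem hab)).1 le_rfl)

lemma map_clampedQuantile [IsProbabilityMeasure ν] (hab : a ≤ b) (hν : ∀ᵐ x ∂ν, x ∈ Icc a b) :
    (volume.restrict (Ioc (0 : ℝ) 1)).map (clampedQuantile a b ν) = ν := by
  have hm : Measurable (clampedQuantile a b ν) :=
    (measurable_clampedQuantile hab (Kernel.const Unit ν)).comp
      (measurable_const (a := ()) |>.prodMk measurable_id)
  refine Measure.ext_of_Iic _ _ fun x => ?_
  rw [Measure.map_apply hm measurableSet_Iic, Measure.restrict_apply (hm measurableSet_Iic)]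
  by_cases hxa : x < a
  · have h1 : clampedQuantile a b ν ⁻¹' Iic x = ∅ := by
      ext p
      simpa using hxa.trans_le (clampedQuantile_mem hab).1
    have h2 : ν (Iic x) = 0 := by
      refine measure_mono_null (fun y hy => ?_) hν
      exact fun h => absurd h.1 (not_le.2 (lt_of_le_of_lt hy hxa))
    simp [h1, h2]
  by_cases hxb : b ≤ x
  · have h1 : clampedQuantile a b ν ⁻¹' Iic x = univ := by
      ext p
      simpa using (clampedQuantile_mem hab).2.trans hxb
    have h2 : ν (Iic x) = 1 := by
      refine (mem_ae_iff_prob_eq_one measurableSet_Iic).1 ?_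
      filter_upwards [hν] with y hy using hy.2.trans hxb
    simp [h1, h2]
  push Not at hxa hxb
  have : clampedQuantile a b ν ⁻¹' Iic x ∩ Ioc 0 1 = Ioc 0 (ν.real (Iic x)) := by
    ext p
    have := measureReal_le_one (μ := ν) (s := Iic x)
    simp only [mem_inter_iff, mem_preimage, mem_Iic, clampedQuantile_le_iff hab ⟨hxa, hxb.le⟩,
      hxb.ne, or_false, mem_Ioc]
    grind
  rw [this, Real.volume_Ioc, sub_zero, ofReal_measureReal]

end Quantile

section InvariantGraphs

open ProbabilityTheory

variable {ω a b : ℝ} {T : Torus → ℝ → ℝ}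

/-- The disintegration of an invariant measure of a skew product is equivariant. -/
lemma condKernel_equivariant (hT : Measurable (Function.uncurry T))
    {ρ : Measure (Torus × ℝ)} [IsProbabilityMeasure ρ] (hfst : ρ.fst = volume)
    (hρ : MeasurePreserving (fun p : Torus × ℝ => (p.1 + (ω : Torus), T p.1 p.2)) ρ ρ) :
    ∀ᵐ θ : Torus, ρ.condKernel (θ + (ω : Torus)) = (ρ.condKernel θ).map (T θ) := by
  have hTθ : ∀ θ, Measurable (T θ) := fun θ => hT.comp measurable_prodMk_left
  have hsub : Measurable fun θ : Torus => θ - (ω : Torus) := by fun_prop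
  let κ : Kernel Torus ℝ :=
    ((Kernel.id ×ₖ ρ.condKernel).map (Function.uncurry T)).comap (fun θ => θ - (ω : Torus)) hsub
  have hκM : IsMarkovKernel κ := by
    have : IsMarkovKernel ((Kernel.id ×ₖ ρ.condKernel).map (Function.uncurry T)) :=
      Kernel.IsMarkovKernel.map _ hT
    exact Kernel.IsMarkovKernel.comap _ hsub
  have hκ : ∀ θ, κ θ = (ρ.condKernel (θ - (ω : Torus))).map (T (θ - (ω : Torus))) := by
    intro θ
    rw [Kernel.comap_apply, Kernel.map_apply _ hT, Kernel.prod_apply, Kernel.id_apply,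
      Measure.dirac_prod, Measure.map_map hT measurable_prodMk_left]
    rfl
  have hdis : ρ = volume ⊗ₘ ρ.condKernel := by
    rw [← hfst]
    exact (ρ.disintegrate ρ.condKernel).symm
  have heq : ρ = ρ.fst ⊗ₘ κ := by
    rw [hfst]
    ext A hA
    rw [Measure.compProd_apply hA, ← hρ.measure_preimage hA.nullMeasurableSet]
    conv_lhs => rw [hdis]
    rw [Measure.compProd_apply (hρ.measurable hA),
      ← lintegral_sub_right_eq_self _ (ω : Torus)]
    refine lintegral_congr fun θ => ?_
    rw [hκ, Measure.map_apply (hTθ _) (measurable_prodMk_left hA)]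
    simp [preimage_preimage]
  have hae := eq_condKernel_of_measure_eq_compProd κ heq
  rw [hfst] at hae
  have hae' := (measurePreserving_add_right volume (ω : Torus)).quasiMeasurePreserving.ae hae
  filter_upwards [hae'] with θ hθ
  rw [← hθ, hκ, add_sub_cancel_right]

/-- An almost everywhere invariant graph can be modified on a null set to a graph which is
invariant everywhere. -/
lemma exists_invariant_ae_eq (hab : a ≤ b) (hTb : ∀ θ, T θ b = b) {u : Torus → ℝ}
    (hu : Measurable u) (humem : ∀ θ, u θ ∈ Icc a b)
    (huinv : ∀ᵐ θ : Torus, T θ (u θ) = u (θ + (ω : Torus))) :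
    ∃ φ : Torus → ℝ, Measurable φ ∧ (∀ θ, φ θ ∈ Icc a b) ∧
      (∀ θ, T θ (φ θ) = φ (θ + (ω : Torus))) ∧ φ =ᵐ[volume] u := by
  classical
  obtain ⟨N, hbad, hNm, hN0⟩ := exists_measurable_superset_of_null huinv
  set G : Set Torus := {θ | ∀ n : ℤ, θ + n • (ω : Torus) ∉ N} with hG
  have hGm : MeasurableSet G := by
    have : G = ⋂ n : ℤ, (fun θ : Torus => θ + n • (ω : Torus)) ⁻¹' Nᶜ := by
      ext θ
      simp [hG]
    rw [this]
    exact MeasurableSet.iInter fun n => measurable_add_const _ hNm.compl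
  have hGae : ∀ᵐ θ : Torus, θ ∈ G := by
    have h0 : ∀ᵐ θ : Torus, θ ∉ N := measure_eq_zero_iff_ae_notMem.1 hN0
    refine ae_all_iff.2 fun n => ?_
    have hpres := measurePreserving_add_right (volume : Measure Torus) (n • (ω : Torus))
    have hae := hpres.quasiMeasurePreserving.ae h0
    exact hae
  have hGinv : ∀ θ, θ + (ω : Torus) ∈ G ↔ θ ∈ G := by
    intro θ
    refine ⟨fun h n => ?_, fun h n => ?_⟩
    · have := h (n - 1)
      rwa [sub_smul, one_smul, add_assoc, add_sub_cancel] at this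
    · have := h (n + 1)
      rwa [add_smul, one_smul, add_comm (n • _), ← add_assoc] at this
  refine ⟨fun θ => if θ ∈ G then u θ else b, Measurable.ite hGm hu measurable_const,
    fun θ => ?_, fun θ => ?_, ?_⟩
  · dsimp only
    split_ifs
    exacts [humem θ, right_mem_Icc.2 hab]
  · by_cases hθ : θ ∈ G
    · have h0 : θ ∉ N := by simpa using hθ 0
      simp only [hθ, hGinv, if_true]
      by_contra hne
      exact h0 (hbad hne)
    · simp [hθ, hGinv, hTb]
  · filter_upwards [hGae] with θ hθ
    simp [hθ]

/-- A measure on a product is parametrised by the fibrewise quantiles of its disintegration. -/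
lemma map_prodMk_clampedQuantile {α : Type*} [MeasurableSpace α] (hab : a ≤ b) (μ : Measure α)
    [IsProbabilityMeasure μ] {κ : Kernel α ℝ} [IsMarkovKernel κ]
    (hκ : ∀ᵐ θ ∂μ, ∀ᵐ x ∂κ θ, x ∈ Icc a b) :
    (μ.prod (volume.restrict (Ioc (0 : ℝ) 1))).map
      (fun p => (p.1, clampedQuantile a b (κ p.1) p.2)) = μ ⊗ₘ κ := by
  have hqm := measurable_clampedQuantile hab κ
  have hQm : Measurable fun p : α × ℝ => (p.1, clampedQuantile a b (κ p.1) p.2) :=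
    measurable_fst.prodMk hqm
  ext A hA
  rw [Measure.map_apply hQm hA, Measure.prod_apply (hQm hA), Measure.compProd_apply hA]
  refine lintegral_congr_ae ?_
  filter_upwards [hκ] with θ hθ
  have hqθ : Measurable (clampedQuantile a b (κ θ)) := hqm.comp measurable_prodMk_left
  conv_rhs => rw [← map_clampedQuantile hab hθ]
  rw [Measure.map_apply hqθ (measurable_prodMk_left hA)]
  rfl

/-- **Furstenberg**: an invariant measure of a monotone skew product with negative mean exponent
yields an invariant graph with negative exponent, contained in the support of the measure. -/
lemma exists_invariant_graph_integral_neg (hab : a ≤ b) (hT : Measurable (Function.uncurry T))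
    (hmono : ∀ θ, StrictMono (T θ)) (hbij : ∀ θ, BijOn (T θ) (Icc a b) (Icc a b))
    {ρ : Measure (Torus × ℝ)} [IsProbabilityMeasure ρ] (hfst : ρ.fst = volume)
    (hρ : MeasurePreserving (fun p : Torus × ℝ => (p.1 + (ω : Torus), T p.1 p.2)) ρ ρ)
    (hρmem : ∀ᵐ p ∂ρ, p.2 ∈ Icc a b) {C : Set (Torus × ℝ)} (hC : MeasurableSet C)
    (hρC : ∀ᵐ p ∂ρ, p ∈ C) {g : Torus × ℝ → ℝ} (hgi : Integrable g ρ)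
    (hg : ∫ p, g p ∂ρ < 0) :
    ∃ φ : Torus → ℝ, Measurable φ ∧ (∀ θ, φ θ ∈ Icc a b) ∧
      (∀ θ, T θ (φ θ) = φ (θ + (ω : Torus))) ∧ ∫ θ, g (θ, φ θ) < 0 ∧
      ∀ᵐ θ : Torus, (θ, φ θ) ∈ C := by
  have hTb : ∀ θ, T θ b = b := by
    intro θ
    obtain ⟨x, hx, hxb⟩ := (hbij θ).surjOn (right_mem_Icc.2 hab)
    refine le_antisymm ((hbij θ).mapsTo (right_mem_Icc.2 hab)).2 ?_
    conv_lhs => rw [← hxb]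
    exact (hmono θ).monotone hx.2
  obtain ⟨κ, hκM, hdis, hκinv⟩ : ∃ κ : Kernel Torus ℝ, IsMarkovKernel κ ∧ ρ = volume ⊗ₘ κ ∧
      ∀ᵐ θ : Torus, κ (θ + (ω : Torus)) = (κ θ).map (T θ) := by
    refine ⟨ρ.condKernel, inferInstance, ?_, condKernel_equivariant hT hfst hρ⟩
    rw [← hfst]
    exact (ρ.disintegrate ρ.condKernel).symm
  set q : Torus × ℝ → ℝ := fun p => clampedQuantile a b (κ p.1) p.2 with hq
  have hqm : Measurable q := measurable_clampedQuantile hab κ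
  set l : Measure ℝ := volume.restrict (Ioc (0 : ℝ) 1) with hl
  have : IsProbabilityMeasure l := ⟨by simp [hl]⟩
  have hκmem : ∀ᵐ θ : Torus, ∀ᵐ x ∂κ θ, x ∈ Icc a b := by
    rw [hdis] at hρmem
    exact Measure.ae_ae_of_ae_compProd hρmem
  have hQm : Measurable fun p : Torus × ℝ => (p.1, q p) := measurable_fst.prodMk hqm
  have hmap : ((volume : Measure Torus).prod l).map (fun p => (p.1, q p)) = ρ := by
    rw [hdis]
    exact map_prodMk_clampedQuantile hab volume hκmem
  rw [← hmap] at hρC hgi hg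
  have hgi' := (integrable_map_measure hgi.aestronglyMeasurable hQm.aemeasurable).1 hgi
  rw [integral_map hQm.aemeasurable hgi.aestronglyMeasurable,
    integral_prod_symm (fun p => g (p.1, q p)) hgi'] at hg
  rw [ae_map_iff (p := (· ∈ C)) hQm.aemeasurable hC] at hρC
  have hswap := (Measure.measurePreserving_swap (μ := l)
    (ν := (volume : Measure Torus))).quasiMeasurePreserving.ae hρC
  have hCs : ∀ᵐ s ∂l, ∀ᵐ θ : Torus, (θ, q (θ, s)) ∈ C :=
    Measure.ae_ae_of_ae_prod hswap
  have hneg : ∃ᶠ s in ae l, ∫ θ : Torus, g (θ, q (θ, s)) < 0 := by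
    intro hcon
    refine absurd hg (not_lt.2 (integral_nonneg_of_ae ?_))
    filter_upwards [hcon] with s hs using not_lt.1 hs
  obtain ⟨s, hs, hsC⟩ := (hneg.and_eventually hCs).exists
  obtain ⟨φ, hφm, hφmem, hφinv, hφeq⟩ := exists_invariant_ae_eq (ω := ω)
    (u := fun θ => q (θ, s)) hab hTb
    (hqm.comp measurable_prodMk_right)
    (fun θ => clampedQuantile_mem hab) (by
      filter_upwards [hκinv] with θ hθ
      have hTθ : Measurable (T θ) := hT.comp measurable_prodMk_left
      simp only [hq]
      rw [hθ, clampedQuantile_map hab hTθ (hmono θ) (hbij θ) (hTb θ)])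
  refine ⟨φ, hφm, hφmem, hφinv, ?_, ?_⟩
  · rwa [integral_congr_ae (g := fun θ => g (θ, q (θ, s)))]
    filter_upwards [hφeq] with θ hθ
    rw [hθ]
  · filter_upwards [hφeq, hsC] with θ hθ hC
    rwa [hθ]

end InvariantGraphs

section Contraction

variable {ω a b : ℝ} {T DT : Torus → ℝ → ℝ}

/-- Birkhoff sums of a continuous function over an irrational rotation grow at most linearly, at
any rate exceeding the mean. -/
lemma exists_forall_sum_rotation_le (hω : Irrational ω) {h : Torus → ℝ} (hh : Continuous h)
    {c : ℝ} (hc : ∫ θ, h θ < c) :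
    ∃ K, ∀ (θ : Torus) (n : ℕ), ∑ i ∈ Finset.range n, h (θ + i • (ω : Torus)) ≤ K + n * c := by
  obtain ⟨N, hN⟩ := eventually_atTop.1 (eventually_forall_birkhoffAverage_rotation_lt hω hh hc)
  obtain ⟨M, hM⟩ := (isCompact_range hh).bddAbove
  have hM' : ∀ θ, h θ ≤ |M| := fun θ => (hM (mem_range_self θ)).trans (le_abs_self M)
  refine ⟨N * (|M| + |c|), fun θ n => ?_⟩
  have hpos : 0 ≤ |M| + |c| := by positivity
  rcases lt_or_ge n N with hn | hn
  · have h1 : ∑ i ∈ Finset.range n, h (θ + i • (ω : Torus)) ≤ n * |M| := by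
      simpa using Finset.sum_le_card_nsmul (Finset.range n) _ _ fun i _ =>
        hM' (θ + i • (ω : Torus))
    have h2 : (n : ℝ) * (|M| + |c|) ≤ N * (|M| + |c|) := by gcongr
    have h3 : (n : ℝ) * -|c| ≤ n * c := by gcongr; exact neg_abs_le c
    linarith
  · rcases Nat.eq_zero_or_pos n with rfl | hn0
    · simp only [Finset.range_zero, Finset.sum_empty, CharP.cast_eq_zero, zero_mul, add_zero]
      positivity
    have hn0' : (0 : ℝ) < n := by exact_mod_cast hn0
    have h1 := hN n hn θ
    simp only [birkhoffAverage, birkhoffSum, add_right_iterate, smul_eq_mul] at h1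
    rw [inv_mul_lt_iff₀ hn0'] at h1
    have : 0 ≤ (N : ℝ) * (|M| + |c|) := by positivity
    linarith

/-- Orbits starting close to a continuous invariant graph with negative exponent have a negative
exponent, with uniform constants. -/
lemma exists_forall_sum_log_deriv_le (hω : Irrational ω)
    (hDTcont : Continuous fun p : Torus × ℝ => DT p.1 p.2)
    (hDTpos : ∀ θ x, 0 < DT θ x) (hderiv : ∀ θ x, HasDerivAt (T θ) (DT θ x) x)
    {ψ : Torus → ℝ} (hψ : Continuous ψ) (hψmem : ∀ θ, ψ θ ∈ Icc a b)
    (hψinv : ∀ θ, T θ (ψ θ) = ψ (θ + (ω : Torus)))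
    (hneg : ∫ θ, Real.log (DT θ (ψ θ)) < 0) :
    ∃ δ > 0, ∃ c > 0, ∃ K, ∀ (θ : Torus) (x : ℕ → ℝ), (∀ n, x n ∈ Icc a b) →
      (∀ n, x (n + 1) = T (θ + n • (ω : Torus)) (x n)) → |x 0 - ψ θ| < δ →
      ∀ n : ℕ, ∑ i ∈ Finset.range n, Real.log (DT (θ + i • (ω : Torus)) (x i)) ≤ K - n * c := by
  set h : Torus → ℝ := fun θ => Real.log (DT θ (ψ θ)) with hh
  have hlog : Continuous fun p : Torus × ℝ => Real.log (DT p.1 p.2) :=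
    hDTcont.log fun p => (hDTpos _ _).ne'
  have hhc : Continuous h := hlog.comp (continuous_id.prodMk hψ)
  obtain ⟨c, hc, hcm⟩ : ∃ c > 0, ∫ θ, h θ < -2 * c :=
    ⟨-(∫ θ, h θ) / 4, by linarith, by linarith⟩
  obtain ⟨K, hK⟩ := exists_forall_sum_rotation_le hω hhc hcm
  have hcpt : IsCompact ((univ : Set Torus) ×ˢ Icc a b) := isCompact_univ.prod isCompact_Icc
  have huc := hcpt.uniformContinuousOn_of_continuous hlog.continuousOn
  obtain ⟨ε, hε, hεc⟩ := Metric.uniformContinuousOn_iff.1 huc c hc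
  have hclose : ∀ θ, ∀ x ∈ Icc a b, |x - ψ θ| < ε → Real.log (DT θ x) ≤ h θ + c := by
    intro θ x hx hxψ
    have := hεc (θ, x) ⟨mem_univ _, hx⟩ (θ, ψ θ) ⟨mem_univ _, hψmem θ⟩
      (by simpa [Prod.dist_eq, Real.dist_eq, hε] using hxψ)
    rw [Real.dist_eq] at this
    linarith [le_abs_self (Real.log (DT θ x) - Real.log (DT θ (ψ θ)))]
  have hstep : ∀ θ, ∀ x ∈ Icc a b, |x - ψ θ| < ε →
      |T θ x - ψ (θ + (ω : Torus))| ≤ Real.exp (h θ + c) * |x - ψ θ| := by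
    intro θ x hx hxψ
    rw [← hψinv]
    refine (convex_uIcc (ψ θ) x).norm_image_sub_le_of_norm_hasDerivWithin_le
      (fun y _ => (hderiv θ y).hasDerivWithinAt) (fun y hy => ?_) left_mem_uIcc right_mem_uIcc
    rw [Real.norm_of_nonneg (hDTpos θ y).le, ← Real.log_le_iff_le_exp (hDTpos θ y)]
    refine hclose θ y (uIcc_subset_Icc (hψmem θ) hx hy) (lt_of_le_of_lt ?_ hxψ)
    exact abs_sub_left_of_mem_uIcc hy
  refine ⟨ε * Real.exp (-K), by positivity, c, hc, K, fun θ x hx hxT hx0 => ?_⟩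
  have hsum : ∀ n : ℕ, ∑ i ∈ Finset.range n, (h (θ + i • (ω : Torus)) + c) ≤ K - n * c := by
    intro n
    rw [Finset.sum_add_distrib, Finset.sum_const, Finset.card_range, nsmul_eq_mul]
    linarith [hK θ n]
  have hsmall : ∀ n : ℕ, Real.exp (∑ i ∈ Finset.range n, (h (θ + i • (ω : Torus)) + c)) *
      |x 0 - ψ θ| < ε := by
    intro n
    have hnc : 0 ≤ n * c := by positivity
    calc _ ≤ Real.exp K * |x 0 - ψ θ| := by gcongr; linarith [hsum n]
      _ < Real.exp K * (ε * Real.exp (-K)) := by gcongr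
      _ = ε := by rw [mul_left_comm, ← Real.exp_add]; simp
  have hdist : ∀ n : ℕ, |x n - ψ (θ + n • (ω : Torus))| ≤
      Real.exp (∑ i ∈ Finset.range n, (h (θ + i • (ω : Torus)) + c)) * |x 0 - ψ θ| := by
    intro n
    induction n with
    | zero => simp
    | succ n ih =>
      have := hstep (θ + n • (ω : Torus)) (x n) (hx n) (ih.trans_lt (hsmall n))
      rw [← hxT, add_assoc, ← succ_nsmul] at this
      refine this.trans ?_
      rw [Finset.sum_range_succ, Real.exp_add _ (h _ + c), mul_comm (Real.exp (Finset.sum _ _)),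
        mul_assoc]
      gcongr
  exact fun n => (Finset.sum_le_sum fun i _ =>
    hclose _ _ (hx i) ((hdist i).trans_lt (hsmall i))).trans (hsum n)

end Contraction

/-- The upper limit of the averages of a bounded sequence is a frequent lower bound. -/
lemma frequently_lt_average_of_lt_limsup {v : ℕ → ℝ} {M c : ℝ} (hv : ∀ i, |v i| ≤ M)
    (h : c < limsup (fun n : ℕ => (1 / (n : ℝ)) * ∑ i ∈ Finset.range n, v i) atTop) :
    ∃ᶠ n : ℕ in atTop, c < (1 / (n : ℝ)) * ∑ i ∈ Finset.range n, v i := by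
  have hM : 0 ≤ M := (abs_nonneg _).trans (hv 0)
  refine frequently_lt_of_lt_limsup ?_ h
  refine IsBoundedUnder.isCoboundedUnder_le
    ⟨-M, eventually_map.2 (Eventually.of_forall fun n => ?_)⟩
  rcases Nat.eq_zero_or_pos n with rfl | hn
  · simpa using hM
  have hn' : (0 : ℝ) < n := by exact_mod_cast hn
  have h1 : ∑ _i ∈ Finset.range n, -M ≤ ∑ i ∈ Finset.range n, v i :=
    Finset.sum_le_sum fun i _ => (abs_le.1 (hv i)).1
  simp only [Finset.sum_const, Finset.card_range, nsmul_eq_mul] at h1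
  rw [one_div, le_inv_mul_iff₀ hn']
  exact h1

/-- **Weak sink-source orbits imply SNA.** Let `T(θ,x) = (θ+ω, T θ x)` be a
quasiperiodically forced monotone interval map with invertible C¹ fibre maps and
continuous strictly positive fibre derivative `DT`. If some bi-infinite orbit
`(θ₀ + nω, ξ n)` has strictly positive upper forward and upper backward Lyapunov
exponents, then there exists a strange non-chaotic attractor: a measurable invariant
graph with negative Lyapunov exponent admitting no continuous representative. -/
theorem weak_sink_source_orbit_implies_SNA
    (ω : ℝ) (hω : Irrational ω) (a b : ℝ) (hab : a ≤ b)
    (T DT : Torus → ℝ → ℝ)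
    (hbij : ∀ θ, BijOn (T θ) (Icc a b) (Icc a b))
    (hmono : ∀ θ, MonotoneOn (T θ) (Icc a b))
    (hcont : Continuous fun p : Torus × ℝ => T p.1 p.2)
    (hDTcont : Continuous fun p : Torus × ℝ => DT p.1 p.2)
    (hDTpos : ∀ θ x, 0 < DT θ x)
    (hderiv : ∀ θ x, HasDerivAt (T θ) (DT θ x) x)
    (θ₀ : Torus) (ξ : ℤ → ℝ) (hξmem : ∀ n, ξ n ∈ Icc a b)
    (hξorb : ∀ n : ℤ, ξ (n + 1) = T (θ₀ + (((n : ℝ) * ω : ℝ) : Torus)) (ξ n))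
    (hplus : 0 < limsup (fun n : ℕ =>
      (1 / (n : ℝ)) * ∑ i ∈ Finset.range n,
        Real.log (DT (θ₀ + (((i : ℝ) * ω : ℝ) : Torus)) (ξ (i : ℤ)))) atTop)
    (hminus : 0 < limsup (fun n : ℕ =>
      -(1 / (n : ℝ)) * ∑ i ∈ Finset.range n,
        Real.log (DT (θ₀ + (((-(i : ℝ) - 1) * ω : ℝ) : Torus)) (ξ (-(i : ℤ) - 1)))) atTop) :
    ∃ φ : Torus → ℝ, Measurable φ ∧ (∀ θ, φ θ ∈ Icc a b) ∧
      (∀ θ, T θ (φ θ) = φ (θ + (ω : Torus))) ∧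
      (∫ θ : Torus, Real.log (DT θ (φ θ))) < 0 ∧
      ∀ ψ : Torus → ℝ, Continuous ψ → ¬ (φ =ᵐ[volume] ψ) := by
  have hωn : ∀ r : ℤ, (((r : ℝ) * ω : ℝ) : Torus) = r • (ω : Torus) := fun r => by
    rw [← zsmul_eq_mul, AddCircle.coe_zsmul]
  have hlog : Continuous fun p : Torus × ℝ => Real.log (DT p.1 p.2) :=
    hDTcont.log fun p => (hDTpos _ _).ne'
  have hstrict : ∀ θ, StrictMono (T θ) := fun θ =>
    strictMono_of_hasDerivAt_pos (hderiv θ) (hDTpos θ)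
  have hcpt : IsCompact ((univ : Set Torus) ×ˢ Icc a b) := isCompact_univ.prod isCompact_Icc
  obtain ⟨M, hM⟩ := hcpt.exists_bound_of_continuousOn hlog.continuousOn
  set o : ℤ → Torus × ℝ := fun k => (θ₀ + k • (ω : Torus), ξ k) with ho
  set g : Torus × ℝ → ℝ := fun p => Real.log (DT p.1 p.2) with hg
  have hoM : ∀ k, |g (o k)| ≤ M := fun k => hM (o k) ⟨mem_univ _, hξmem k⟩
  have hostep : ∀ k, o (k + 1) = ((o k).1 + (ω : Torus), T (o k).1 (o k).2) := by
    intro k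
    simp only [ho, hξorb k, hωn, add_smul, one_smul, add_assoc]
  have hplus' : ∃ᶠ n : ℕ in atTop, 0 < (1 / (n : ℝ)) * ∑ i ∈ Finset.range n, g (o i) := by
    refine frequently_lt_average_of_lt_limsup (fun i => hoM i) ?_
    convert hplus using 9
    exact (hωn _).symm
  obtain ⟨c, hc, hminus'⟩ : ∃ c > 0, ∃ᶠ n : ℕ in atTop,
      c < (1 / (n : ℝ)) * ∑ i ∈ Finset.range n, -g (o (-(i : ℤ) - 1)) := by
    obtain ⟨c, hc, hclt⟩ := exists_between hminus
    refine ⟨c, hc, frequently_lt_average_of_lt_limsup (M := M)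
      (fun i => by rw [abs_neg]; exact hoM _) ?_⟩
    convert hclt using 3 with n
    rw [Finset.sum_neg_distrib, mul_neg, neg_mul]
    congr 2
    refine Finset.sum_congr rfl fun i _ => ?_
    have := hωn (-(i : ℤ) - 1)
    push_cast at this
    simp only [hg, ho, this]
  set C : Set (Torus × ℝ) := closure (o '' Iic 0)
  let S : Torus × Icc a b → Torus × Icc a b :=
    fun p => (p.1 + (ω : Torus), ⟨T p.1 p.2, (hbij p.1).mapsTo p.2.2⟩)
  have hS : Continuous S := by
    refine (by fun_prop : Continuous fun p : Torus × Icc a b => p.1 + (ω : Torus)).prodMk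
      (Continuous.subtype_mk ?_ _)
    exact hcont.comp (continuous_fst.prodMk (continuous_subtype_val.comp continuous_snd))
  let ι : Torus × Icc a b → Torus × ℝ := fun p => (p.1, p.2)
  have hι : Continuous ι := continuous_fst.prodMk (continuous_subtype_val.comp continuous_snd)
  let o' : ℤ → Torus × Icc a b := fun k => (θ₀ + k • (ω : Torus), ⟨ξ k, hξmem k⟩)
  have hιo : ∀ k, ι (o' k) = o k := fun k => rfl
  have hSo : ∀ (n : ℕ) (k : ℤ), S^[n] (o' k) = o' (k + n) := by
    intro n
    induction n with
    | zero => simp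
    | succ n ih =>
      intro k
      rw [Function.iterate_succ_apply', ih]
      have := hostep (k + n)
      rw [Prod.ext_iff] at this
      refine Prod.ext ?_ (Subtype.ext ?_)
      · push_cast
        rw [← add_assoc]
        exact this.1.symm
      · push_cast
        rw [← add_assoc]
        exact this.2.symm
  obtain ⟨μ, hμ, hpres, hgμ, hCμ⟩ := exists_invariant_measure_of_frequently_birkhoffAverage_le hS
    (hlog.comp hι) (fun n => o' (-(n : ℤ))) (c := -c) (hminus'.mono fun n hn => by
      rw [birkhoffAverage, birkhoffSum, ← Finset.sum_range_reflect]
      rw [Finset.sum_neg_distrib, mul_neg, one_div] at hn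
      refine le_trans (le_of_eq ?_) (le_neg_of_le_neg hn.le)
      rw [smul_eq_mul]
      congr 1
      refine Finset.sum_congr rfl fun i hi => ?_
      have hi' := Finset.mem_range.1 hi
      rw [Function.comp_apply, hSo, hιo]
      congr 2
      omega) (isClosed_closure.preimage hι : IsClosed (ι ⁻¹' C)) (fun n i hi => by
      rw [hSo]
      exact subset_closure ⟨-n + i, by simp only [mem_Iic]; omega, rfl⟩)
  have hρι : MeasurePreserving ι μ (μ.map ι) := hι.measurable.measurePreserving μ
  set ρ := μ.map ι with hρ
  have : IsProbabilityMeasure ρ := Measure.isProbabilityMeasure_map hι.measurable.aemeasurable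
  have hTm : Measurable (Function.uncurry T) := hcont.measurable
  have hSρ : MeasurePreserving (fun p : Torus × ℝ => (p.1 + (ω : Torus), T p.1 p.2)) ρ ρ := by
    have hm : Measurable fun p : Torus × ℝ => (p.1 + (ω : Torus), T p.1 p.2) :=
      (measurable_fst.add_const _).prodMk hTm
    refine ⟨hm, ?_⟩
    rw [hρ, Measure.map_map hm hι.measurable]
    exact (hρι.comp hpres).map_eq
  have hfst : ρ.fst = volume := by
    refine eq_volume_of_measurePreserving_irrational_rotation hω _ ⟨by fun_prop, ?_⟩
    have h1 := congrArg Measure.fst hSρ.map_eq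
    conv_rhs => rw [← h1]
    rw [Measure.fst, Measure.fst, Measure.map_map (by fun_prop) measurable_fst,
      Measure.map_map measurable_fst hSρ.measurable]
    rfl
  have hgι : Integrable (g ∘ ι) μ := (hlog.comp hι).integrable_of_hasCompactSupport
    (HasCompactSupport.of_compactSpace _)
  have hgρ : Integrable g ρ :=
    (integrable_map_measure hlog.aestronglyMeasurable hι.measurable.aemeasurable).2 hgι
  have hgρneg : ∫ p, g p ∂ρ < 0 := by
    rw [hρ, integral_map hι.measurable.aemeasurable hlog.aestronglyMeasurable]
    exact hgμ.trans_lt (by linarith)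
  obtain ⟨φ, hφm, hφmem, hφinv, hφneg, hφC⟩ := exists_invariant_graph_integral_neg hab hTm hstrict
    hbij hfst hSρ
    ((ae_map_iff (p := fun p : Torus × ℝ => p.2 ∈ Icc a b) hι.measurable.aemeasurable
      (measurable_snd measurableSet_Icc)).2 (Eventually.of_forall fun p => p.2.2))
    (isClosed_closure (s := o '' Iic 0)).measurableSet
    ((ae_map_iff (p := (· ∈ C)) hι.measurable.aemeasurable
      isClosed_closure.measurableSet).2 hCμ) hgρ hgρneg
  refine ⟨φ, hφm, hφmem, hφinv, hφneg, fun ψ hψ hφψ => ?_⟩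
  have hclosed : ∀ P : Torus → Prop, IsClosed {θ | P θ} → (∀ᵐ θ : Torus, P θ) → ∀ θ, P θ := by
    intro P hs hae
    have := (Measure.dense_of_ae hae).closure_eq
    rw [hs.closure_eq] at this
    exact fun θ => eq_univ_iff_forall.1 this θ
  have hψmem : ∀ θ, ψ θ ∈ Icc a b :=
    hclosed (fun θ => ψ θ ∈ Icc a b) (isClosed_Icc.preimage hψ) (by
      filter_upwards [hφψ] with θ hθ
      rw [← hθ]
      exact hφmem θ)
  have hψC : ∀ θ, (θ, ψ θ) ∈ C :=
    hclosed (fun θ => (θ, ψ θ) ∈ C) (isClosed_closure.preimage (continuous_id.prodMk hψ)) (by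
      filter_upwards [hφψ, hφC] with θ hθ hθC
      rw [← hθ]
      exact hθC)
  have hψinv : ∀ θ, T θ (ψ θ) = ψ (θ + (ω : Torus)) :=
    hclosed (fun θ => T θ (ψ θ) = ψ (θ + (ω : Torus)))
      (isClosed_eq (hcont.comp (continuous_id.prodMk hψ)) (by fun_prop)) (by
        have hpres := measurePreserving_add_right (volume : Measure Torus) (ω : Torus)
        have hshift := hpres.quasiMeasurePreserving.ae hφψ
        filter_upwards [hφψ, hshift] with θ h1 h2
        simpa [h1, h2] using hφinv θ)
  have hψneg : ∫ θ, Real.log (DT θ (ψ θ)) < 0 := by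
    rwa [integral_congr_ae (g := fun θ => g (θ, φ θ))]
    filter_upwards [hφψ] with θ hθ
    rw [← hθ]
  obtain ⟨δ, hδ, d, hd, K, hK⟩ := exists_forall_sum_log_deriv_le hω hDTcont hDTpos hderiv hψ hψmem
    hψinv hψneg
  obtain ⟨_, hk, k, hk0, rfl⟩ := mem_closure_iff.1 (hψC 0) {p | |p.2 - ψ p.1| < δ}
    (isOpen_lt (by fun_prop) continuous_const) (by simpa using hδ)
  obtain ⟨m, rfl⟩ : ∃ m : ℕ, k = -m := ⟨k.natAbs, by simp only [mem_Iic] at hk0; omega⟩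
  have hsum : ∀ n : ℕ, ∑ i ∈ Finset.range n, g (o i) ≤ K + m * M - n * d := by
    intro n
    have h1 := hK (o (-m)).1 (fun i => ξ (-m + i)) (fun i => hξmem _) (fun i => by
      have := congrArg Prod.snd (hostep (-m + i))
      simp only [ho, add_smul, natCast_zsmul, ← add_assoc] at this ⊢
      push_cast
      rw [← add_assoc]
      exact this) (by simpa using hk) (m + n)
    have h2 : ∀ i : ℕ, Real.log (DT ((o (-m)).1 + i • (ω : Torus)) (ξ (-m + i))) =
        g (o (-m + i)) := by
      intro i
      simp only [hg, ho, add_smul, natCast_zsmul, ← add_assoc]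
    simp only [h2] at h1
    rw [Finset.sum_range_add] at h1
    have h3 : ∑ _i ∈ Finset.range m, -M ≤ ∑ i ∈ Finset.range m, g (o (-m + (i : ℤ))) :=
      Finset.sum_le_sum fun i _ => (abs_le.1 (hoM _)).1
    simp only [Finset.sum_const, Finset.card_range, nsmul_eq_mul] at h3
    have hmd : 0 ≤ m * d := by positivity
    push_cast at h1
    simp only [neg_add_cancel_left] at h1
    linarith
  obtain ⟨N, hN⟩ := exists_nat_gt ((K + m * M) / d)
  obtain ⟨n, hn, hnN⟩ := (hplus'.and_eventually (eventually_ge_atTop N)).exists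
  have hnd : (K + m * M) / d < n := hN.trans_le (by exact_mod_cast hnN)
  rw [div_lt_iff₀ hd] at hnd
  have hle := hsum n
  exact absurd hn (not_lt.2 (mul_nonpos_of_nonneg_of_nonpos (by positivity) (by linarith)))
end

section
/- Let α satisfy √α ≥ 2K, and F differentiable with 2α^{−2} ≤ F'(x) ≤ α² everywhere and F'(x) ≥ 2√α for |x| ≤ 2/α. Let (x¹_j), (x²_j) be orbits x^i_{j+1} = F(x^i_j) − c^i_j with |c¹_j − c²_j| ≤ K·ε where ε ≤ α^{−q}, q ≥ 1. Suppose x²_1 ≥ x¹_1 + (ε/2)·α^r with 0 ≤ r < q, and for all j = 1,…,n: (i) x¹_j ∈ [−1/α,1/α] implies x²_j ∈ [−2/α,2/α], and (ii) r + (1/2)(j − 5τ(j)) ≥ 1/2, where τ(j) := #{ i ∈ [1,j] : x¹_i ∉ [−1/α,1/α] }. Then x²_{n+1} ≥ x¹_{n+1} + (ε/2)·α^{r + (1/2)(n − 5τ(n))}. -/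
open Set
open scoped Classical

/-- `τ(j) = #{ i ∈ [1,j] : x¹_i ∉ [-1/α, 1/α] }`, the number of times the reference
orbit leaves the expanding region up to time `j`. -/
noncomputable def tauCount (α : ℝ) (x1 : ℕ → ℝ) (j : ℕ) : ℕ :=
  ((Finset.Icc 1 j).filter fun i => x1 i ∉ Icc (-(1 / α)) (1 / α)).card

theorem tauCount_zero (α : ℝ) (x : ℕ → ℝ) : tauCount α x 0 = 0 := by
  simp [tauCount]

theorem tauCount_succ_of_mem {α : ℝ} {x : ℕ → ℝ} {j : ℕ}
    (h : x (j + 1) ∈ Icc (-(1 / α)) (1 / α)) :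
    tauCount α x (j + 1) = tauCount α x j := by
  unfold tauCount
  rw [← Finset.insert_Icc_right_eq_Icc_add_one (by omega : 1 ≤ j + 1), Finset.filter_insert,
    if_neg (not_not.mpr h)]

theorem tauCount_succ_of_notMem {α : ℝ} {x : ℕ → ℝ} {j : ℕ}
    (h : x (j + 1) ∉ Icc (-(1 / α)) (1 / α)) :
    tauCount α x (j + 1) = tauCount α x j + 1 := by
  unfold tauCount
  rw [← Finset.insert_Icc_right_eq_Icc_add_one (by omega : 1 ≤ j + 1), Finset.filter_insert,
    if_pos h, Finset.card_insert_of_notMem (by simp)]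

theorem mul_sub_le_image_sub_of_le_hasDerivAt {F F' : ℝ → ℝ} {a b m : ℝ}
    (hF : ∀ x, HasDerivAt F (F' x) x) (hab : a ≤ b) (hm : ∀ x ∈ Icc a b, m ≤ F' x) :
    m * (b - a) ≤ F b - F a :=
  (convex_Icc a b).mul_sub_le_image_sub_of_le_deriv
    (fun x _ => (hF x).continuousAt.continuousWithinAt)
    (fun x _ => (hF x).differentiableAt.differentiableWithinAt)
    (fun x hx => (hF x).deriv.symm ▸ hm x (interior_subset hx))
    a (left_mem_Icc.2 hab) b (right_mem_Icc.2 hab) hab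

/-- One step of the gap recursion: a derivative bound `2α^s` on the segment between two points
with gap at least `(ε/2)α^e` yields the gap `(ε/2)α^(e+s)` after a perturbation of size `Kε`,
provided `e + s ≥ 1/2`. -/
theorem gap_le_of_two_mul_rpow_le_deriv {α K ε e s a b u v : ℝ} {F F' : ℝ → ℝ}
    (hα : 1 < α) (hαK : 2 * K ≤ Real.sqrt α) (hε : 0 < ε)
    (hF : ∀ x, HasDerivAt F (F' x) x) (huv : |u - v| ≤ K * ε)
    (hgap : a + (ε / 2) * α ^ e ≤ b) (hs : ∀ x ∈ Icc a b, 2 * α ^ s ≤ F' x)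
    (hes : 1 / 2 ≤ e + s) :
    F a - u + (ε / 2) * α ^ (e + s) ≤ F b - v := by
  have hα0 : 0 < α := by linarith
  have he : 0 < (ε / 2) * α ^ e := by positivity
  have hmvt := mul_sub_le_image_sub_of_le_hasDerivAt hF (by linarith) hs
  have hgrow : 2 * α ^ s * ((ε / 2) * α ^ e) ≤ 2 * α ^ s * (b - a) :=
    mul_le_mul_of_nonneg_left (by linarith) (by positivity)
  have hpow : α ^ (e + s) = α ^ e * α ^ s := Real.rpow_add hα0 e s
  have hK : 2 * K ≤ α ^ (e + s) := by
    rw [Real.sqrt_eq_rpow] at hαK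
    exact hαK.trans (Real.rpow_le_rpow_of_exponent_le hα.le hes)
  have habsorb : (ε / 2) * (2 * K) ≤ (ε / 2) * α ^ (e + s) :=
    mul_le_mul_of_nonneg_left hK (by positivity)
  have hcu := (abs_le.mp huv).1
  have hgrow_eq : 2 * α ^ s * ((ε / 2) * α ^ e) = 2 * ((ε / 2) * α ^ (e + s)) := by
    rw [hpow]; ring
  linarith

/-- **Orbit expansion, quantitative version.** If the orbits `x¹, x²` are driven by
`Kε`-close terms with `ε ≤ α^{-q}`, the gap starts at `(ε/2)·α^r` with `0 ≤ r < q`,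
and for every `j ≤ n` both `x¹_j ∈ [-1/α,1/α] → x²_j ∈ [-2/α,2/α]` and
`r + (1/2)(j - 5τ(j)) ≥ 1/2` hold, then
`x²_{n+1} ≥ x¹_{n+1} + (ε/2)·α^{r + (1/2)(n - 5τ(n))}`. -/
theorem orbit_expansion
    (α K ε q r : ℝ)
    (hα : 1 < α) (hαK : 2 * K ≤ Real.sqrt α)
    (hq : 1 ≤ q) (hε : 0 < ε) (hεq : ε ≤ α ^ (-q))
    (hr0 : 0 ≤ r) (hrq : r < q)
    (F F' : ℝ → ℝ)
    (hderiv : ∀ x : ℝ, HasDerivAt F (F' x) x)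
    (hlow : ∀ x : ℝ, 2 / α ^ 2 ≤ F' x)
    (hup : ∀ x : ℝ, F' x ≤ α ^ 2)
    (hexp : ∀ x : ℝ, |x| ≤ 2 / α → 2 * Real.sqrt α ≤ F' x)
    (x1 x2 c1 c2 : ℕ → ℝ)
    (hrec1 : ∀ j : ℕ, 1 ≤ j → x1 (j + 1) = F (x1 j) - c1 j)
    (hrec2 : ∀ j : ℕ, 1 ≤ j → x2 (j + 1) = F (x2 j) - c2 j)
    (hc : ∀ j : ℕ, |c1 j - c2 j| ≤ K * ε)
    (hstart : x1 1 + (ε / 2) * α ^ r ≤ x2 1)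
    (n : ℕ)
    (hcond : ∀ j : ℕ, 1 ≤ j → j ≤ n →
      (x1 j ∈ Icc (-(1 / α)) (1 / α) → x2 j ∈ Icc (-(2 / α)) (2 / α)) ∧
      (1 / 2 : ℝ) ≤ r + (1 / 2) * ((j : ℝ) - 5 * (tauCount α x1 j : ℝ))) :
    x1 (n + 1) + (ε / 2) * α ^ (r + (1 / 2) * ((n : ℝ) - 5 * (tauCount α x1 n : ℝ)))
      ≤ x2 (n + 1) := by
  induction n with
  | zero => simpa [tauCount_zero] using hstart
  | succ n ih =>
    have hgap := ih fun j hj hjn => hcond j hj (by omega)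
    obtain ⟨hmem, hexponent⟩ := hcond (n + 1) (by omega) le_rfl
    have hα0 : 0 < α := by linarith
    rw [hrec1 (n + 1) (by omega), hrec2 (n + 1) (by omega)]
    by_cases h : x1 (n + 1) ∈ Icc (-(1 / α)) (1 / α)
    · rw [tauCount_succ_of_mem h] at hexponent ⊢
      have he : r + (1 / 2) * (((n + 1 : ℕ) : ℝ) - 5 * (tauCount α x1 n : ℝ)) =
          r + (1 / 2) * ((n : ℝ) - 5 * (tauCount α x1 n : ℝ)) + 1 / 2 := by
        push_cast; ring
      rw [he] at hexponent ⊢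
      refine gap_le_of_two_mul_rpow_le_deriv hα hαK hε hderiv (hc (n + 1)) hgap
        (fun x hx => ?_) hexponent
      rw [← Real.sqrt_eq_rpow]
      have hle : 1 / α ≤ 2 / α := by gcongr; norm_num
      exact hexp x (abs_le.mpr ⟨by linarith [h.1, hx.1], hx.2.trans (hmem h).2⟩)
    · rw [tauCount_succ_of_notMem h] at hexponent ⊢
      have he : r + (1 / 2) * (((n + 1 : ℕ) : ℝ) - 5 * ((tauCount α x1 n + 1 : ℕ) : ℝ)) =
          r + (1 / 2) * ((n : ℝ) - 5 * (tauCount α x1 n : ℝ)) + -2 := by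
        push_cast; ring
      rw [he] at hexponent ⊢
      refine gap_le_of_two_mul_rpow_le_deriv hα hαK hε hderiv (hc (n + 1)) hgap
        (fun x _ => ?_) hexponent
      rw [Real.rpow_neg hα0.le, Real.rpow_two, ← div_eq_mul_inv]
      exact hlow x
end
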